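/- Let (X,d,μ) be a geometrically doubling metric measure space, where μ is a nonnegative Radon measure, let 1 < p ≤ q < ∞, β ∈ (1,∞) and k ∈ (1,∞). Then there exists a constant C > 0 such that for all f ∈ M_p^{q,(k)}(X): ‖M_0^{(β)} f‖_{M_p^{q,(k)}(X)} ≤ C ‖f‖_{M_p^{q,(k)}(X)}. -/

import Mathlib

open MeasureTheory Metric ENNReal

/-- `(X,d)` is geometrically doubling with constant `N₀`. -/
def GeomDoubling (X : Type*) [MetricSpace X] (N₀ : ℕ) : Prop :=
  ∀ (x : X) (r : ℝ) (s : Finset X), (↑s : Set X) ⊆ ball x r →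
    (∀ y ∈ s, ∀ z ∈ s, y ≠ z → r / 2 < dist y z) → s.card ≤ N₀

/-- The modified Morrey norm for real-valued functions. -/
noncomputable def modMorreyNorm {X : Type*} [MetricSpace X] [MeasurableSpace X]
    (μ : Measure X) (p q k : ℝ) (f : X → ℝ) : ℝ≥0∞ :=
  ⨆ (x : X) (r : ℝ) (_ : 0 < r),
    μ (ball x (k * r)) ^ (1 / q - 1 / p) *
      (∫⁻ y in ball x r, (‖f y‖₊ : ℝ≥0∞) ^ p ∂μ) ^ (1 / p)

/-- The modified Morrey norm for `ℝ≥0∞`-valued functions. -/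
noncomputable def modMorreyNormE {X : Type*} [MetricSpace X] [MeasurableSpace X]
    (μ : Measure X) (p q k : ℝ) (f : X → ℝ≥0∞) : ℝ≥0∞ :=
  ⨆ (x : X) (r : ℝ) (_ : 0 < r),
    μ (ball x (k * r)) ^ (1 / q - 1 / p) *
      (∫⁻ y in ball x r, (f y) ^ p ∂μ) ^ (1 / p)

/-- The modified maximal operator `M_0^{(β)} f(x) = sup_{r>0} μ(B(x,βr))⁻¹ ∫_{B(x,r)} |f| dμ`. -/
noncomputable def modMax {X : Type*} [MetricSpace X] [MeasurableSpace X]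
    (μ : Measure X) (β : ℝ) (f : X → ℝ) (x : X) : ℝ≥0∞ :=
  ⨆ (r : ℝ) (_ : 0 < r),
    (μ (ball x (β * r)))⁻¹ * ∫⁻ y in ball x r, (‖f y‖₊ : ℝ≥0∞) ∂μ

theorem GeomDoubling.card_le_pow {X : Type*} [MetricSpace X] {N₀ : ℕ} (hX : GeomDoubling X N₀)
    (n : ℕ) : ∀ (x : X) (R : ℝ) (s : Finset X), 0 < R → (↑s : Set X) ⊆ ball x R →
      (∀ y ∈ s, ∀ z ∈ s, y ≠ z → (2 / 3) ^ n * R < dist y z) → s.card ≤ N₀ ^ (n + 1) := by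
  classical
  induction n with
  | zero =>
    intro x R s hR hs hsep
    rw [zero_add, pow_one]
    refine hX x R s hs fun y hy z hz hyz => ?_
    have := hsep y hy z hz hyz
    rw [pow_zero, one_mul] at this
    linarith
  | succ n ih =>
    intro x R s hR hs hsep
    obtain ⟨t, ht, htmax⟩ := (s.powerset.filter fun t : Finset X =>
        ∀ y ∈ t, ∀ z ∈ t, y ≠ z → R / 2 < dist y z).exists_max_image Finset.card
        ⟨∅, by simp⟩
    simp only [Finset.mem_filter, Finset.mem_powerset] at ht htmax
    have hcover : s ⊆ t.biUnion fun y => s.filter fun z => z ∈ ball y (2 / 3 * R) := by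
      intro z hz
      simp only [Finset.mem_biUnion, Finset.mem_filter, mem_ball]
      by_contra! hcon
      have hfar : ∀ y ∈ t, 2 / 3 * R ≤ dist z y := fun y hy => hcon y hy hz
      have hzt : z ∉ t := fun hzt => by
        have := hfar z hzt
        rw [dist_self] at this
        linarith
      have := htmax (insert z t) ⟨Finset.insert_subset hz ht.1, by
        intro a ha b hb hab
        rcases Finset.mem_insert.1 ha with rfl | ha' <;> rcases Finset.mem_insert.1 hb with rfl | hb'
        · exact absurd rfl hab
        · linarith [hfar b hb']
        · rw [dist_comm]; linarith [hfar a ha']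
        · exact ht.2 a ha' b hb' hab⟩
      rw [Finset.card_insert_of_notMem hzt] at this
      omega
    calc s.card ≤ _ := Finset.card_le_card hcover
      _ ≤ t.card * N₀ ^ (n + 1) := by
        refine Finset.card_biUnion_le_card_mul _ _ _ fun y _ => ?_
        refine ih y (2 / 3 * R) _ (by positivity) (fun z hz => ?_) fun a ha b hb hab => ?_
        · exact (Finset.mem_filter.1 hz).2
        · have := hsep a (Finset.mem_filter.1 ha).1 b (Finset.mem_filter.1 hb).1 hab
          rwa [pow_succ, mul_assoc] at this
      _ ≤ N₀ * N₀ ^ (n + 1) := by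
        gcongr
        exact hX x R t (fun y hy => hs (ht.1 hy)) ht.2
      _ = N₀ ^ (n + 1 + 1) := by ring

theorem GeomDoubling.exists_packing_bound {X : Type*} [MetricSpace X] {N₀ : ℕ}
    (hX : GeomDoubling X N₀) {ε : ℝ} (hε : 0 < ε) :
    ∃ N : ℕ, ∀ (x : X) (R : ℝ) (s : Finset X), 0 < R → (↑s : Set X) ⊆ ball x R →
      (∀ y ∈ s, ∀ z ∈ s, y ≠ z → ε * R ≤ dist y z) → s.card ≤ N := by
  obtain ⟨n, hn⟩ := exists_pow_lt_of_lt_one hε (show (2 / 3 : ℝ) < 1 by norm_num)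
  refine ⟨N₀ ^ (n + 1), fun x R s hR hs hsep => hX.card_le_pow n x R s hR hs ?_⟩
  intro y hy z hz hyz
  exact lt_of_lt_of_le (by gcongr) (hsep y hy z hz hyz)

theorem GeomDoubling.exists_finset_cover {X : Type*} [MetricSpace X] {N₀ : ℕ}
    (hX : GeomDoubling X N₀) {ε : ℝ} (hε : 0 < ε) :
    ∃ N : ℕ, ∀ (x : X) (R : ℝ), 0 < R → ∃ t : Finset X, (↑t : Set X) ⊆ ball x R ∧
      t.card ≤ N ∧ ball x R ⊆ ⋃ y ∈ t, ball y (ε * R) := by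
  classical
  obtain ⟨N, hN⟩ := hX.exists_packing_bound hε
  refine ⟨N, fun x R hR => ?_⟩
  let P : ℕ → Prop := fun m => ∃ t : Finset X, (↑t : Set X) ⊆ ball x R ∧
    (∀ y ∈ t, ∀ z ∈ t, y ≠ z → ε * R ≤ dist y z) ∧ t.card = m
  have hP : P (Nat.findGreatest P N) :=
    Nat.findGreatest_spec (m := 0) (Nat.zero_le _) ⟨∅, by simp, by simp, rfl⟩
  obtain ⟨t, ht, hsep, hcard⟩ := hP
  refine ⟨t, ht, hN x R t hR ht hsep, fun z hz => ?_⟩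
  simp only [Set.mem_iUnion, mem_ball, exists_prop]
  by_contra! hfar
  have hzt : z ∉ t := fun hzt => by
    have := hfar z hzt
    rw [dist_self] at this
    nlinarith [mul_pos hε hR]
  have hsub : (↑(insert z t) : Set X) ⊆ ball x R := by
    rw [Finset.coe_insert]
    exact Set.insert_subset hz ht
  have hsep' : ∀ a ∈ insert z t, ∀ b ∈ insert z t, a ≠ b → ε * R ≤ dist a b := by
    intro a ha b hb hab
    rcases Finset.mem_insert.1 ha with rfl | ha' <;> rcases Finset.mem_insert.1 hb with rfl | hb'
    · exact absurd rfl hab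
    · exact hfar b hb'
    · rw [dist_comm]; exact hfar a ha'
    · exact hsep a ha' b hb' hab
  have := Nat.le_findGreatest (hN x R _ hR hsub hsep') (show P _ from ⟨_, hsub, hsep', rfl⟩)
  rw [Finset.card_insert_of_notMem hzt, hcard] at this
  omega

theorem GeomDoubling.secondCountableTopology {X : Type*} [MetricSpace X] {N₀ : ℕ}
    (hX : GeomDoubling X N₀) : SecondCountableTopology X := by
  rcases isEmpty_or_nonempty X with hE | ⟨⟨x₀⟩⟩
  · infer_instance
  refine Metric.secondCountable_of_almost_dense_set fun ε hε => ?_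
  have hcov : ∀ n : ℕ, ∃ t : Finset X, ball x₀ (n + 1 : ℝ) ⊆ ⋃ y ∈ t, ball y ε := by
    intro n
    have hn : (0 : ℝ) < n + 1 := by positivity
    obtain ⟨N, hN⟩ := hX.exists_finset_cover (show 0 < ε / (n + 1) by positivity)
    obtain ⟨t, -, -, ht⟩ := hN x₀ (n + 1) hn
    exact ⟨t, by rwa [div_mul_cancel₀ _ hn.ne'] at ht⟩
  choose t ht using hcov
  refine ⟨⋃ n, (t n : Set X), Set.countable_iUnion fun n => (t n).countable_toSet, fun x => ?_⟩
  obtain ⟨n, hn⟩ := exists_nat_gt (dist x x₀)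
  have hx := ht n (show x ∈ ball x₀ (n + 1 : ℝ) by rw [mem_ball]; linarith)
  simp only [Set.mem_iUnion, exists_prop, mem_ball] at hx
  obtain ⟨y, hy, hxy⟩ := hx
  exact ⟨y, Set.mem_iUnion.2 ⟨n, hy⟩, hxy.le⟩

theorem exists_separated_subfamily {X : Type*} [MetricSpace X] (ρ : X → ℝ) {b : ℝ} (hb : 0 < b)
    (T : Finset X) (hρ : ∀ x ∈ T, 0 < ρ x) :
    ∃ S ⊆ T, (∀ x ∈ T, ∃ y ∈ S, ρ x ≤ ρ y ∧ dist x y < b * ρ y) ∧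
      ∀ x ∈ S, ∀ y ∈ S, x ≠ y → b * ρ x ≤ dist x y := by
  classical
  induction T using Finset.induction_on_min_value ρ with
  | empty => exact ⟨∅, by simp⟩
  | insert a T haT hmin ih =>
    obtain ⟨S, hST, hcov, hsep⟩ := ih fun x hx => hρ x (Finset.mem_insert_of_mem hx)
    by_cases ha : ∃ y ∈ S, dist a y < b * ρ y
    · obtain ⟨y, hy, hay⟩ := ha
      refine ⟨S, hST.trans (Finset.subset_insert _ _), fun x hx => ?_, hsep⟩
      rcases Finset.mem_insert.1 hx with rfl | hx
      · exact ⟨y, hy, hmin y (hST hy), hay⟩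
      · exact hcov x hx
    · push Not at ha
      refine ⟨insert a S, Finset.insert_subset_insert _ hST, fun x hx => ?_, ?_⟩
      · rcases Finset.mem_insert.1 hx with rfl | hx
        · refine ⟨x, Finset.mem_insert_self _ _, le_rfl, ?_⟩
          rw [dist_self]
          exact mul_pos hb (hρ x (Finset.mem_insert_self _ _))
        · obtain ⟨y, hy, h⟩ := hcov x hx
          exact ⟨y, Finset.mem_insert_of_mem hy, h⟩
      · intro x hx y hy hxy
        rcases Finset.mem_insert.1 hx with rfl | hx' <;> rcases Finset.mem_insert.1 hy with rfl | hy'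
        · exact absurd rfl hxy
        · exact (mul_le_mul_of_nonneg_left (hmin y (hST hy')) hb.le).trans (ha y hy')
        · rw [dist_comm]; exact ha x hx'
        · exact hsep x hx' y hy' hxy

theorem GeomDoubling.exists_overlap_bound {X : Type*} [MetricSpace X] {N₀ : ℕ}
    (hX : GeomDoubling X N₀) {b : ℝ} (hb : 1 < b) :
    ∃ N : ℕ, ∀ (ρ : X → ℝ) (S : Finset X) (z : X),
      (∀ x ∈ S, ∀ y ∈ S, x ≠ y → b * ρ x ≤ dist x y) → (∀ x ∈ S, z ∈ ball x (ρ x)) →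
      S.card ≤ N := by
  obtain ⟨N, hN⟩ := hX.exists_packing_bound (sub_pos.2 hb)
  refine ⟨N, fun ρ S z hsep hz => ?_⟩
  rcases S.eq_empty_or_nonempty with rfl | hne
  · simp
  obtain ⟨m, hm, hmax⟩ := S.exists_max_image ρ hne
  have hpos : ∀ x ∈ S, 0 < ρ x := fun x hx => dist_nonneg.trans_lt (hz x hx)
  refine hN z (ρ m) S (hpos m hm) (fun x hx => ?_) fun x hx y hy hxy => ?_
  · rw [mem_ball, dist_comm]
    exact (hz x hx).trans_le (hmax x hx)
  · have hxy' := hsep x hx y hy hxy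
    have hx0 := hpos x hx
    by_cases hxm : x = m
    · subst hxm
      linarith
    · have h1 := hsep m hm x hx (Ne.symm hxm)
      have h2 := dist_triangle_left m x z
      have h3 := hz x hx
      have h4 := hz m hm
      rw [mem_ball] at h3 h4
      nlinarith

theorem weak_type_modMax {X : Type*} [MetricSpace X] [MeasurableSpace X] [BorelSpace X]
    {N₀ : ℕ} (hX : GeomDoubling X N₀) (μ : Measure X) {β : ℝ} (hβ : 1 < β) :
    ∃ N : ℕ, ∀ f : X → ℝ, Measurable f → ∀ t : ℝ≥0∞,
      t * μ {x | t < modMax μ β f x} ≤ N * ∫⁻ y, (‖f y‖₊ : ℝ≥0∞) ∂μ := by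
  classical
  have := hX.secondCountableTopology
  obtain ⟨b, hb1, hbβ⟩ := exists_between hβ
  obtain ⟨N, hN⟩ := hX.exists_overlap_bound hb1
  refine ⟨N, fun f hf t => ?_⟩
  have hrad : ∀ x : X, ∃ r : ℝ, t < modMax μ β f x → 0 < r ∧
      t * μ (ball x (β * r)) ≤ ∫⁻ y in ball x r, (‖f y‖₊ : ℝ≥0∞) ∂μ := by
    intro x
    by_cases hx : t < modMax μ β f x
    · simp only [modMax, lt_iSup_iff] at hx
      obtain ⟨r, hr, hlt⟩ := hx
      refine ⟨r, fun _ => ⟨hr, ENNReal.mul_le_of_le_div ?_⟩⟩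
      rw [ENNReal.div_eq_inv_mul]
      exact hlt.le
    · exact ⟨0, fun h => absurd h hx⟩
  choose ρ hρ using hrad
  set E := {x | t < modMax μ β f x} with hE
  obtain ⟨A, hAE, hAc, hA⟩ := TopologicalSpace.isOpen_biUnion_countable E
    (fun x => ball x ((β - b) * ρ x)) fun _ _ => isOpen_ball
  have hEA : E ⊆ ⋃ x ∈ A, ball x ((β - b) * ρ x) := by
    rw [hA]
    intro x hx
    refine Set.mem_biUnion hx (mem_ball_self ?_)
    exact mul_pos (sub_pos.2 hbβ) (hρ x hx).1
  have hfin : ∀ T : Finset X, (↑T : Set X) ⊆ E →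
      t * μ (⋃ x ∈ T, ball x ((β - b) * ρ x)) ≤ N * ∫⁻ y, (‖f y‖₊ : ℝ≥0∞) ∂μ := by
    intro T hT
    obtain ⟨S, hST, hcov, hsep⟩ := exists_separated_subfamily ρ (zero_lt_one.trans hb1) T
      fun x hx => (hρ x (hT hx)).1
    have hsub : (⋃ x ∈ T, ball x ((β - b) * ρ x)) ⊆ ⋃ y ∈ S, ball y (β * ρ y) := by
      refine Set.iUnion₂_subset fun x hx => ?_
      obtain ⟨y, hy, hxy, hd⟩ := hcov x hx
      refine (ball_subset_ball' ?_).trans (Set.subset_biUnion_of_mem (u := fun y => ball y (β * ρ y)) hy)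
      nlinarith
    calc t * μ (⋃ x ∈ T, ball x ((β - b) * ρ x))
        ≤ t * ∑ y ∈ S, μ (ball y (β * ρ y)) := by
          gcongr
          exact (measure_mono hsub).trans (measure_biUnion_finset_le _ _)
      _ ≤ ∑ y ∈ S, ∫⁻ z in ball y (ρ y), (‖f z‖₊ : ℝ≥0∞) ∂μ := by
          rw [Finset.mul_sum]
          exact Finset.sum_le_sum fun y hy => (hρ y (hT (hST hy))).2
      _ = ∫⁻ z, ∑ y ∈ S, (ball y (ρ y)).indicator (fun z => (‖f z‖₊ : ℝ≥0∞)) z ∂μ := by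
          rw [lintegral_finsetSum]
          · exact Finset.sum_congr rfl fun y _ => (lintegral_indicator measurableSet_ball _).symm
          · intro y _
            exact (by fun_prop : Measurable fun z => (‖f z‖₊ : ℝ≥0∞)).indicator measurableSet_ball
      _ ≤ ∫⁻ z, N * (‖f z‖₊ : ℝ≥0∞) ∂μ := by
          refine lintegral_mono fun z => ?_
          simp only [Set.indicator_apply]
          rw [← Finset.sum_filter, Finset.sum_const, nsmul_eq_mul]
          gcongr
          refine hN ρ _ z (fun x hx y hy => hsep x (Finset.mem_filter.1 hx).1 y
            (Finset.mem_filter.1 hy).1) fun x hx => (Finset.mem_filter.1 hx).2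
      _ = N * ∫⁻ y, (‖f y‖₊ : ℝ≥0∞) ∂μ := lintegral_const_mul _ (by fun_prop)
  have := hAc.to_subtype
  have hAU : (⋃ x ∈ A, ball x ((β - b) * ρ x)) ⊆
      ⋃ T : Finset A, ⋃ x ∈ T.map (Function.Embedding.subtype _), ball x ((β - b) * ρ x) := by
    refine Set.iUnion₂_subset fun x hx => ?_
    refine Set.subset_iUnion_of_subset {⟨x, hx⟩} ?_
    simp
  have hdir : Directed (· ⊆ ·) fun T : Finset A =>
      ⋃ x ∈ T.map (Function.Embedding.subtype _), ball x ((β - b) * ρ x) := by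
    refine Monotone.directed_le fun T₁ T₂ h => ?_
    exact Set.biUnion_subset_biUnion_left fun x hx => Finset.map_subset_map.2 h hx
  calc t * μ E ≤ t * μ (⋃ T : Finset A, ⋃ x ∈ T.map (Function.Embedding.subtype _),
        ball x ((β - b) * ρ x)) := by
        gcongr
        exact hEA.trans hAU
    _ ≤ N * ∫⁻ y, (‖f y‖₊ : ℝ≥0∞) ∂μ := by
        rw [hdir.measure_iUnion, ENNReal.mul_iSup]
        refine iSup_le fun T => hfin _ fun x hx => ?_
        simp only [Finset.coe_map, Set.mem_image] at hx
        obtain ⟨y, -, rfl⟩ := hx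
        exact hAE y.2

theorem lowerSemicontinuous_measure_ball {X : Type*} [MetricSpace X] [MeasurableSpace X]
    (ν : Measure X) (r : ℝ) : LowerSemicontinuous fun x => ν (ball x r) := by
  intro x a ha
  have hU : ball x r = ⋃ n : ℕ, ball x (r - 1 / (n + 1)) := by
    ext y
    simp only [Set.mem_iUnion, mem_ball]
    refine ⟨fun h => ?_, fun ⟨n, h⟩ => h.trans_le (sub_le_self _ (by positivity))⟩
    obtain ⟨n, hn⟩ := exists_nat_one_div_lt (sub_pos.2 h)
    exact ⟨n, by linarith⟩
  have hmono : Monotone fun n : ℕ => ball x (r - 1 / ((n : ℝ) + 1)) := by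
    intro m n hmn
    refine ball_subset_ball ?_
    gcongr
  change a < ν (ball x r) at ha
  rw [hU, hmono.measure_iUnion, lt_iSup_iff] at ha
  obtain ⟨n, hn⟩ := ha
  filter_upwards [ball_mem_nhds x (show (0 : ℝ) < 1 / (n + 1) by positivity)] with y hy
  refine hn.trans_le (measure_mono (ball_subset_ball' ?_))
  rw [mem_ball, dist_comm] at hy
  linarith

theorem measurable_modMax {X : Type*} [MetricSpace X] [MeasurableSpace X] [BorelSpace X]
    (μ : Measure X) {β : ℝ} (hβ : 0 < β) (f : X → ℝ) :
    Measurable (modMax μ β f) := by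
  have hrat : modMax μ β f = fun x => ⨆ (r : ℚ) (_ : 0 < r),
      (μ (ball x (β * r)))⁻¹ * μ.withDensity (fun y => (‖f y‖₊ : ℝ≥0∞)) (ball x r) := by
    funext x
    simp only [withDensity_apply _ measurableSet_ball]
    refine le_antisymm (iSup₂_le fun r hr => le_of_forall_lt fun a ha => ?_)
      (iSup₂_le fun r hr => le_iSup₂_of_le (r : ℝ) (by exact_mod_cast hr) le_rfl)
    have hU : ball x r = ⋃ s : {s : ℚ // 0 < s ∧ (s : ℝ) < r}, ball x (s : ℝ) := by
      ext y
      simp only [Set.mem_iUnion, mem_ball]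
      refine ⟨fun h => ?_, fun ⟨s, h⟩ => h.trans s.2.2⟩
      obtain ⟨s, hs1, hs2⟩ := exists_rat_btwn h
      exact ⟨⟨s, by exact_mod_cast dist_nonneg.trans_lt hs1, hs2⟩, hs1⟩
    have hdir : Directed (· ⊆ ·) fun s : {s : ℚ // 0 < s ∧ (s : ℝ) < r} => ball x (s : ℝ) := by
      refine Monotone.directed_le fun s t hst => ball_subset_ball ?_
      exact_mod_cast hst
    rw [hU, setLIntegral_iUnion_of_directed _ hdir, ENNReal.mul_iSup, lt_iSup_iff] at ha
    obtain ⟨s, hs⟩ := ha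
    refine hs.trans_le (le_iSup₂_of_le s.1 s.2.1 ?_)
    gcongr
    exact s.2.2.le
  rw [hrat]
  refine Measurable.iSup fun r => Measurable.iSup fun _ => ?_
  exact (lowerSemicontinuous_measure_ball _ _).measurable.inv.mul
    (lowerSemicontinuous_measure_ball _ _).measurable

theorem lintegral_rpow_le_of_truncated_weak_type {X : Type*} [MeasurableSpace X] (μ : Measure X)
    {p : ℝ} (hp : 1 < p) {N : ℝ≥0∞} (hN : N ≠ ⊤) :
    ∃ C : ℝ≥0∞, C ≠ ⊤ ∧ ∀ (h : X → ℝ≥0∞) (f : X → ℝ), Measurable h → Measurable f →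
      (∀ t : ℝ, 0 < t → ENNReal.ofReal t * μ {x | ENNReal.ofReal (2 * t) < h x} ≤
        N * ∫⁻ x in {x | t < |f x|}, (‖f x‖₊ : ℝ≥0∞) ∂μ) →
      ∫⁻ x, h x ^ p ∂μ ≤ C * ∫⁻ x, (‖f x‖₊ : ℝ≥0∞) ^ p ∂μ := by
  have hp0 : 0 < p := by linarith
  have hp1 : 0 < p - 1 := by linarith
  refine ⟨ENNReal.ofReal p * (2 * N * ((ENNReal.ofReal (p - 1))⁻¹ * ENNReal.ofReal (2 ^ (p - 1)))),
    by finiteness [(ENNReal.ofReal_pos.2 hp1).ne'], fun h f hh hf hweak => ?_⟩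
  have hnf : Measurable fun x => (‖f x‖₊ : ℝ≥0∞) := by fun_prop
  set ν := μ.withDensity fun x => (‖f x‖₊ : ℝ≥0∞) with hν
  have hlayer : ENNReal.ofReal (p - 1) *
      ∫⁻ t in Set.Ioi (0 : ℝ), ν {x | t < 2 * |f x|} * ENNReal.ofReal (t ^ (p - 1 - 1)) =
      ENNReal.ofReal (2 ^ (p - 1)) * ∫⁻ x, (‖f x‖₊ : ℝ≥0∞) ^ p ∂μ := by
    rw [← lintegral_rpow_eq_lintegral_meas_lt_mul ν (f := fun x => 2 * |f x|)
      (Filter.Eventually.of_forall fun x => by positivity) (by fun_prop) hp1, hν,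
      lintegral_withDensity_eq_lintegral_mul _ hnf (by fun_prop), ← lintegral_const_mul' _ _ (by simp)]
    refine lintegral_congr fun x => ?_
    have hfx : (‖f x‖₊ : ℝ≥0∞) = ENNReal.ofReal |f x| := by
      rw [← Real.norm_eq_abs, ofReal_norm, enorm_eq_nnnorm]
    rw [Pi.mul_apply, hfx, ENNReal.ofReal_rpow_of_nonneg (abs_nonneg _) hp0.le,
      ← ENNReal.ofReal_mul (abs_nonneg _), ← ENNReal.ofReal_mul (by positivity),
      Real.mul_rpow (by norm_num) (abs_nonneg _)]
    congr 1
    have : |f x| ^ p = |f x| ^ (p - 1) * |f x| := by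
      conv_lhs => rw [show p = (p - 1) + 1 by ring]
      rw [Real.rpow_add' (abs_nonneg _) (by linarith), Real.rpow_one]
    rw [this]
    ring
  have htrunc : ∀ n : ℕ, ∫⁻ x, (min (h x) n) ^ p ∂μ ≤
      ENNReal.ofReal p * (2 * N * ((ENNReal.ofReal (p - 1))⁻¹ * ENNReal.ofReal (2 ^ (p - 1)))) *
        ∫⁻ x, (‖f x‖₊ : ℝ≥0∞) ^ p ∂μ := by
    intro n
    have hne : ∀ x, min (h x) (n : ℝ≥0∞) ≠ ⊤ := fun x =>
      ((min_le_right _ _).trans_lt (ENNReal.natCast_lt_top n)).ne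
    have hpt : ∀ t ∈ Set.Ioi (0 : ℝ),
        μ {x | t < (min (h x) (n : ℝ≥0∞)).toReal} * ENNReal.ofReal (t ^ (p - 1)) ≤
        2 * N * (ν {x | t < 2 * |f x|} * ENNReal.ofReal (t ^ (p - 1 - 1))) := by
      intro t ht
      have ht0 : 0 < t := ht
      have hsub : μ {x | t < (min (h x) (n : ℝ≥0∞)).toReal} ≤
          μ {x | ENNReal.ofReal (2 * (t / 2)) < h x} := by
        refine measure_mono fun x hx => ?_
        rw [Set.mem_ofPred_eq, mul_div_cancel₀ _ two_ne_zero]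
        exact ((ENNReal.ofReal_lt_iff_lt_toReal ht0.le (hne x)).2 hx).trans_le (min_le_left _ _)
      have hνt : ν {x | t < 2 * |f x|} = ∫⁻ x in {x | t / 2 < |f x|}, (‖f x‖₊ : ℝ≥0∞) ∂μ := by
        rw [hν, withDensity_apply _ (measurableSet_lt (by fun_prop) (by fun_prop))]
        congr 2
        ext x
        simp only [Set.mem_ofPred_eq]
        constructor <;> intro <;> linarith
      have hsplit : ENNReal.ofReal (t ^ (p - 1)) =
          ENNReal.ofReal (t / 2) * (2 * ENNReal.ofReal (t ^ (p - 1 - 1))) := by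
        rw [← ENNReal.ofReal_ofNat 2, ← ENNReal.ofReal_mul (by norm_num),
          ← ENNReal.ofReal_mul (by positivity), Real.rpow_sub_one ht0.ne' (p - 1)]
        congr 1
        field_simp
      calc μ {x | t < (min (h x) (n : ℝ≥0∞)).toReal} * ENNReal.ofReal (t ^ (p - 1))
          ≤ μ {x | ENNReal.ofReal (2 * (t / 2)) < h x} * ENNReal.ofReal (t ^ (p - 1)) := by gcongr
        _ = ENNReal.ofReal (t / 2) * μ {x | ENNReal.ofReal (2 * (t / 2)) < h x} *
            (2 * ENNReal.ofReal (t ^ (p - 1 - 1))) := by rw [hsplit]; ring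
        _ ≤ N * ν {x | t < 2 * |f x|} * (2 * ENNReal.ofReal (t ^ (p - 1 - 1))) := by
            rw [hνt]
            gcongr ?_ * _
            exact hweak (t / 2) (by positivity)
        _ = _ := by ring
    calc ∫⁻ x, (min (h x) n) ^ p ∂μ
        = ∫⁻ x, ENNReal.ofReal ((min (h x) (n : ℝ≥0∞)).toReal ^ p) ∂μ := by
          refine lintegral_congr fun x => ?_
          rw [← ENNReal.ofReal_rpow_of_nonneg ENNReal.toReal_nonneg hp0.le,
            ENNReal.ofReal_toReal (hne x)]
      _ = ENNReal.ofReal p * ∫⁻ t in Set.Ioi (0 : ℝ),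
            μ {x | t < (min (h x) (n : ℝ≥0∞)).toReal} * ENNReal.ofReal (t ^ (p - 1)) :=
          lintegral_rpow_eq_lintegral_meas_lt_mul μ
            (Filter.Eventually.of_forall fun x => ENNReal.toReal_nonneg) (by fun_prop) hp0
      _ ≤ ENNReal.ofReal p * ∫⁻ t in Set.Ioi (0 : ℝ),
            2 * N * (ν {x | t < 2 * |f x|} * ENNReal.ofReal (t ^ (p - 1 - 1))) := by
          exact mul_le_mul' le_rfl (setLIntegral_mono' measurableSet_Ioi hpt)
      _ = _ := by
          rw [lintegral_const_mul' _ _ (by finiteness), mul_assoc (ENNReal.ofReal p),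
            mul_assoc (2 * N), mul_assoc _⁻¹, ← hlayer,
            ENNReal.inv_mul_cancel_left (ENNReal.ofReal_pos.2 hp1).ne' (by simp)]
  refine le_of_tendsto' (lintegral_tendsto_of_tendsto_of_monotone
    (f := fun (n : ℕ) x => (min (h x) (n : ℝ≥0∞)) ^ p) (F := fun x => h x ^ p)
    (fun n => by fun_prop) (Filter.Eventually.of_forall fun x m n hmn => ?_)
    (Filter.Eventually.of_forall fun x => ?_)) htrunc
  · dsimp only
    gcongr
  · have := (tendsto_const_nhds (x := h x)).min ENNReal.tendsto_nat_nhds_top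
    rw [min_top_right] at this
    exact this.ennrpow_const p

theorem modMax_le_indicator_add {X : Type*} [MetricSpace X] [MeasurableSpace X]
    (μ : Measure X) {β : ℝ} (hβ : 1 ≤ β) (f : X → ℝ) (t : ℝ) (x : X) :
    modMax μ β f x ≤ modMax μ β ({y | t < |f y|}.indicator f) x + ENNReal.ofReal t := by
  refine iSup₂_le fun r hr => ?_
  have hpt : ∀ y, (‖f y‖₊ : ℝ≥0∞) ≤
      (‖{y | t < |f y|}.indicator f y‖₊ : ℝ≥0∞) + ENNReal.ofReal t := by
    intro y
    by_cases hy : t < |f y|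
    · rw [Set.indicator_of_mem (show y ∈ {y | t < |f y|} from hy)]
      exact le_self_add
    · refine le_add_left ?_
      rw [← enorm_eq_nnnorm, ← ofReal_norm, Real.norm_eq_abs]
      exact ENNReal.ofReal_le_ofReal (not_lt.1 hy)
  calc (μ (ball x (β * r)))⁻¹ * ∫⁻ y in ball x r, (‖f y‖₊ : ℝ≥0∞) ∂μ
      ≤ (μ (ball x (β * r)))⁻¹ * (∫⁻ y in ball x r,
          (‖{y | t < |f y|}.indicator f y‖₊ : ℝ≥0∞) ∂μ + ENNReal.ofReal t * μ (ball x (β * r))) := by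
        gcongr
        refine (lintegral_mono hpt).trans ?_
        rw [lintegral_add_right _ measurable_const, setLIntegral_const]
        gcongr 1
        refine mul_le_mul' le_rfl (measure_mono ?_)
        exact ball_subset_ball (le_mul_of_one_le_left hr.le hβ)
    _ ≤ _ := by
        rw [mul_add]
        gcongr ?_ + ?_
        · exact le_iSup₂_of_le r hr le_rfl
        · rw [mul_left_comm]
          exact mul_le_of_le_one_right' (ENNReal.inv_mul_le_one _)

theorem lintegral_modMax_rpow_le {X : Type*} [MetricSpace X] [MeasurableSpace X] [BorelSpace X]
    {N₀ : ℕ} (hX : GeomDoubling X N₀) (μ : Measure X) {β p : ℝ} (hβ : 1 < β) (hp : 1 < p) :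
    ∃ C : ℝ≥0∞, C ≠ ⊤ ∧ ∀ f : X → ℝ, Measurable f →
      ∫⁻ x, modMax μ β f x ^ p ∂μ ≤ C * ∫⁻ x, (‖f x‖₊ : ℝ≥0∞) ^ p ∂μ := by
  obtain ⟨N, hN⟩ := weak_type_modMax hX μ hβ
  obtain ⟨C, hC, h⟩ := lintegral_rpow_le_of_truncated_weak_type μ hp (ENNReal.natCast_ne_top N)
  refine ⟨C, hC, fun f hf => h _ f (measurable_modMax μ (by linarith) f) hf fun t ht => ?_⟩
  have hset : MeasurableSet {y | t < |f y|} := measurableSet_lt (by fun_prop) (by fun_prop)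
  calc ENNReal.ofReal t * μ {x | ENNReal.ofReal (2 * t) < modMax μ β f x}
      ≤ ENNReal.ofReal t *
          μ {x | ENNReal.ofReal t < modMax μ β ({y | t < |f y|}.indicator f) x} := by
        refine mul_le_mul' le_rfl (measure_mono fun x hx => ?_)
        rw [Set.mem_ofPred_eq] at hx ⊢
        have := hx.trans_le (modMax_le_indicator_add μ hβ.le f t x)
        rw [two_mul, ENNReal.ofReal_add ht.le ht.le] at this
        exact lt_of_add_lt_add_right this
    _ ≤ N * ∫⁻ y, (‖{y | t < |f y|}.indicator f y‖₊ : ℝ≥0∞) ∂μ := hN _ (hf.indicator hset) _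
    _ = _ := by
        rw [← lintegral_indicator hset]
        congr 2
        ext y
        by_cases hy : y ∈ {y | t < |f y|} <;> simp [hy]

theorem ENNReal.rpow_le_rpow_of_exponent_nonpos {a b : ℝ≥0∞} {s : ℝ} (hab : a ≤ b) (hs : s ≤ 0) :
    b ^ s ≤ a ^ s := by
  rw [← neg_neg s, ENNReal.rpow_neg a, ENNReal.rpow_neg b, ENNReal.inv_le_inv]
  exact ENNReal.rpow_le_rpow hab (neg_nonneg.2 hs)

theorem GeomDoubling.exists_morrey_ball_bound {X : Type*} [MetricSpace X] [MeasurableSpace X]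
    {N₀ : ℕ} (hX : GeomDoubling X N₀) (μ : Measure X) {p s ε : ℝ} (hp : 1 ≤ p) (hs : s ≤ 0)
    (hε : 0 < ε) :
    ∃ N : ℕ, ∀ (g : X → ℝ≥0∞) (x : X) (R K : ℝ) (D : Set X) (A : ℝ≥0∞), 0 < R →
      (∀ y ∈ ball x R, ball y (K * (ε * R)) ⊆ D) →
      (∀ y ∈ ball x R, μ (ball y (K * (ε * R))) ^ s *
        (∫⁻ z in ball y (ε * R), g z ^ p ∂μ) ^ (1 / p) ≤ A) →
      μ D ^ s * (∫⁻ z in ball x R, g z ^ p ∂μ) ^ (1 / p) ≤ N * A := by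
  obtain ⟨N, hN⟩ := hX.exists_finset_cover hε
  refine ⟨N, fun g x R K D A hR hD hA => ?_⟩
  have hp0 : 0 < p := by linarith
  obtain ⟨t, ht, hcard, hcov⟩ := hN x R hR
  have hint : ∫⁻ z in ball x R, g z ^ p ∂μ ≤ ∑ y ∈ t, ∫⁻ z in ball y (ε * R), g z ^ p ∂μ := by
    calc ∫⁻ z in ball x R, g z ^ p ∂μ
        ≤ ∫⁻ z in ⋃ y : t, ball (y : X) (ε * R), g z ^ p ∂μ := by
          refine lintegral_mono_set fun z hz => ?_
          simpa using hcov hz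
      _ ≤ ∑' y : t, ∫⁻ z in ball (y : X) (ε * R), g z ^ p ∂μ := lintegral_iUnion_le _ _
      _ = _ := Finset.tsum_subtype t fun y => ∫⁻ z in ball y (ε * R), g z ^ p ∂μ
  calc μ D ^ s * (∫⁻ z in ball x R, g z ^ p ∂μ) ^ (1 / p)
      ≤ μ D ^ s * ∑ y ∈ t, (∫⁻ z in ball y (ε * R), g z ^ p ∂μ) ^ (1 / p) := by
        gcongr
        refine (ENNReal.rpow_le_rpow hint (by positivity)).trans ?_
        refine Finset.le_sum_of_subadditive (fun a : ℝ≥0∞ => a ^ (1 / p))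
          (ENNReal.zero_rpow_of_pos (by positivity)).le (fun a b => ?_) _ _
        exact ENNReal.rpow_add_le_add_rpow a b (by positivity) ((div_le_one hp0).2 hp)
    _ ≤ ∑ _y ∈ t, A := by
        rw [Finset.mul_sum]
        refine Finset.sum_le_sum fun y hy => le_trans ?_ (hA y (ht hy))
        gcongr ?_ * _
        exact ENNReal.rpow_le_rpow_of_exponent_nonpos (measure_mono (hD y (ht hy))) hs
    _ ≤ N * A := by
        rw [Finset.sum_const, nsmul_eq_mul]
        gcongr

theorem modMorreyNorm_ball_le {X : Type*} [MetricSpace X] [MeasurableSpace X]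
    (μ : Measure X) (p q k : ℝ) (f : X → ℝ) (x : X) {r : ℝ} (hr : 0 < r) :
    μ (ball x (k * r)) ^ (1 / q - 1 / p) * (∫⁻ y in ball x r, (‖f y‖₊ : ℝ≥0∞) ^ p ∂μ) ^ (1 / p) ≤
      modMorreyNorm μ p q k f :=
  le_iSup_of_le x (le_iSup₂_of_le r hr le_rfl)

theorem lintegral_le_rpow_mul_measure_rpow {X : Type*} [MeasurableSpace X] (μ : Measure X)
    {p : ℝ} (hp : 1 < p) {g : X → ℝ≥0∞} (hg : Measurable g) (s : Set X) :
    ∫⁻ y in s, g y ∂μ ≤ (∫⁻ y in s, g y ^ p ∂μ) ^ (1 / p) * μ s ^ (1 - 1 / p) := by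
  have hconj := Real.HolderConjugate.conjExponent hp
  have h := ENNReal.lintegral_mul_le_Lp_mul_Lq (μ.restrict s) hconj hg.aemeasurable
    (aemeasurable_const (b := (1 : ℝ≥0∞)))
  have he : 1 / p.conjExponent = 1 - 1 / p := by
    have := hconj.inv_add_inv_eq_one
    rw [one_div, one_div]
    linarith
  simpa [he] using h

theorem GeomDoubling.exists_average_bound {X : Type*} [MetricSpace X] [MeasurableSpace X]
    [BorelSpace X] {N₀ : ℕ} (hX : GeomDoubling X N₀) (μ : Measure X) {p q β k : ℝ} (hp : 1 < p)
    (hpq : p ≤ q) (hβ : 1 < β) (hk : 0 < k) :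
    ∃ N : ℕ, ∀ f : X → ℝ, Measurable f → ∀ (y : X) (r : ℝ), 0 < r →
      (μ (ball y (β * r)))⁻¹ * ∫⁻ z in ball y r, (‖f z‖₊ : ℝ≥0∞) ∂μ ≤
        N * modMorreyNorm μ p q k f * μ (ball y (β * r)) ^ (-(1 / q)) := by
  have hp0 : 0 < p := by linarith
  have hs : 1 / q - 1 / p ≤ 0 := sub_nonpos.2 (one_div_le_one_div_of_le hp0 hpq)
  have hε : 0 < (β - 1) / k := div_pos (by linarith) hk
  obtain ⟨N, hN⟩ := hX.exists_morrey_ball_bound μ hp.le hs hε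
  refine ⟨N, fun f hf y r hr => ?_⟩
  have hball : ball y r ⊆ ball y (β * r) := ball_subset_ball (le_mul_of_one_le_left hr.le hβ.le)
  have hbound := hN (fun z => (‖f z‖₊ : ℝ≥0∞)) y r k (ball y (β * r)) _ hr
    (fun z hz => ball_subset_ball' (by
      rw [mem_ball] at hz
      have : k * ((β - 1) / k * r) = (β - 1) * r := by field_simp
      linarith))
    fun z _ => modMorreyNorm_ball_le μ p q k f z (mul_pos hε hr)
  set m := μ (ball y (β * r)) with hm
  rcases eq_or_ne m 0 with h0 | h0
  · have : ∫⁻ z in ball y r, (‖f z‖₊ : ℝ≥0∞) ∂μ = 0 :=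
      setLIntegral_measure_zero _ _ (measure_mono_null hball h0)
    rw [this, mul_zero]
    exact zero_le
  rcases eq_or_ne m ⊤ with ht | ht
  · rw [ht, ENNReal.inv_top, zero_mul]
    exact zero_le
  calc m⁻¹ * ∫⁻ z in ball y r, (‖f z‖₊ : ℝ≥0∞) ∂μ
      ≤ m⁻¹ * ((∫⁻ z in ball y r, (‖f z‖₊ : ℝ≥0∞) ^ p ∂μ) ^ (1 / p) * m ^ (1 - 1 / p)) := by
        gcongr
        refine (lintegral_le_rpow_mul_measure_rpow μ hp (by fun_prop) _).trans ?_
        refine mul_le_mul' le_rfl (ENNReal.rpow_le_rpow (measure_mono hball) ?_)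
        exact sub_nonneg.2 ((div_le_one hp0).2 hp.le)
    _ = m ^ (1 / q - 1 / p) * (∫⁻ z in ball y r, (‖f z‖₊ : ℝ≥0∞) ^ p ∂μ) ^ (1 / p) *
          m ^ (-(1 / q)) := by
        have : m⁻¹ * m ^ (1 - 1 / p) = m ^ (1 / q - 1 / p) * m ^ (-(1 / q)) := by
          rw [← ENNReal.rpow_neg_one, ← ENNReal.rpow_add _ _ h0 ht, ← ENNReal.rpow_add _ _ h0 ht]
          congr 1
          ring
        rw [mul_left_comm, this]
        ring
    _ ≤ _ := by gcongr

theorem ENNReal.rpow_mul_rpow_mul_rpow_le_one (m : ℝ≥0∞) {a b c : ℝ} (hb : b < 0) (hc : 0 < c)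
    (habc : a + b + c = 0) : m ^ a * m ^ b * m ^ c ≤ 1 := by
  rcases eq_or_ne m 0 with rfl | h0
  · simp [ENNReal.zero_rpow_of_pos hc]
  rcases eq_or_ne m ⊤ with rfl | ht
  · simp [ENNReal.top_rpow_of_neg hb]
  rw [← ENNReal.rpow_add _ _ h0 ht, ← ENNReal.rpow_add _ _ h0 ht, habc, ENNReal.rpow_zero]

theorem GeomDoubling.exists_modMax_ball_bound {X : Type*} [MetricSpace X] [MeasurableSpace X]
    [BorelSpace X] {N₀ : ℕ} (hX : GeomDoubling X N₀) (μ : Measure X) {p q β k : ℝ} (hp : 1 < p)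
    (hpq : p ≤ q) (hβ : 1 < β) (hk : 0 < k) :
    ∃ C : ℝ≥0∞, C ≠ ⊤ ∧ ∀ f : X → ℝ, Measurable f → ∀ (x : X) (r : ℝ), 0 < r →
      μ (ball x ((k + 3) * r)) ^ (1 / q - 1 / p) *
        (∫⁻ y in ball x r, modMax μ β f y ^ p ∂μ) ^ (1 / p) ≤ C * modMorreyNorm μ p q k f := by
  have hp0 : 0 < p := by linarith
  have hq0 : 0 < q := by linarith
  have hs : 1 / q - 1 / p ≤ 0 := sub_nonpos.2 (one_div_le_one_div_of_le hp0 hpq)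
  obtain ⟨C, hC, hstrong⟩ := lintegral_modMax_rpow_le hX μ hβ hp
  obtain ⟨N₁, hN₁⟩ := hX.exists_average_bound μ hp hpq hβ hk
  obtain ⟨N₂, hN₂⟩ := hX.exists_morrey_ball_bound μ hp.le hs (show (0 : ℝ) < 1 / 3 by norm_num)
  refine ⟨C ^ (1 / p) * N₂ + N₁, by finiteness, fun f hf x r hr => ?_⟩
  set A := modMorreyNorm μ p q k f with hA
  set f₁ := (ball x (3 * r)).indicator f with hf₁
  set m := μ (ball x r) with hm
  set c := N₁ * A * m ^ (-(1 / q)) with hc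
  have hmax : ∀ y ∈ ball x r, modMax μ β f y ≤ modMax μ β f₁ y ⊔ c := by
    intro y hy
    rw [mem_ball] at hy
    refine iSup₂_le fun t ht => ?_
    rcases le_or_gt t (2 * r) with htr | htr
    · refine le_sup_of_le_left (le_iSup₂_of_le t ht (le_of_eq ?_))
      congr 1
      refine setLIntegral_congr_fun measurableSet_ball fun z hz => ?_
      have : z ∈ ball x (3 * r) := ball_subset_ball' (by linarith) hz
      simp only [hf₁, Set.indicator_of_mem this]
    · refine le_sup_of_le_right ((hN₁ f hf y t ht).trans ?_)
      rw [hc]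
      gcongr _ * ?_
      refine ENNReal.rpow_le_rpow_of_exponent_nonpos (measure_mono (ball_subset_ball' ?_))
        (neg_nonpos.2 (by positivity))
      rw [dist_comm]
      nlinarith
  have hlocal : (∫⁻ y, modMax μ β f₁ y ^ p ∂μ) ^ (1 / p) ≤
      C ^ (1 / p) * (∫⁻ y in ball x (3 * r), (‖f y‖₊ : ℝ≥0∞) ^ p ∂μ) ^ (1 / p) := by
    rw [← ENNReal.mul_rpow_of_nonneg _ _ (by positivity : 0 ≤ 1 / p)]
    refine ENNReal.rpow_le_rpow ((hstrong f₁ (hf.indicator measurableSet_ball)).trans_eq ?_)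
      (by positivity)
    rw [← lintegral_indicator measurableSet_ball]
    congr 2
    ext y
    by_cases hy : y ∈ ball x (3 * r)
    · simp only [hf₁, Set.indicator_of_mem hy]
    · simp [hf₁, Set.indicator_of_notMem hy, hp0]
  have hsplit : (∫⁻ y in ball x r, modMax μ β f y ^ p ∂μ) ^ (1 / p) ≤
      C ^ (1 / p) * (∫⁻ y in ball x (3 * r), (‖f y‖₊ : ℝ≥0∞) ^ p ∂μ) ^ (1 / p) +
        c * m ^ (1 / p) := by
    calc (∫⁻ y in ball x r, modMax μ β f y ^ p ∂μ) ^ (1 / p)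
        ≤ (∫⁻ y in ball x r, (modMax μ β f₁ y ^ p + c ^ p) ∂μ) ^ (1 / p) := by
          refine ENNReal.rpow_le_rpow (setLIntegral_mono' measurableSet_ball fun y hy => ?_)
            (by positivity)
          refine (ENNReal.rpow_le_rpow (hmax y hy) hp0.le).trans ?_
          rcases le_total (modMax μ β f₁ y) c with h | h
          · rw [sup_eq_right.2 h]; exact le_add_self
          · rw [sup_eq_left.2 h]; exact le_self_add
      _ ≤ (∫⁻ y, modMax μ β f₁ y ^ p ∂μ + c ^ p * m) ^ (1 / p) := by
          refine ENNReal.rpow_le_rpow ?_ (by positivity)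
          rw [lintegral_add_right _ measurable_const, setLIntegral_const]
          exact add_le_add_left (setLIntegral_le_lintegral _ _) _
      _ ≤ (∫⁻ y, modMax μ β f₁ y ^ p ∂μ) ^ (1 / p) + (c ^ p * m) ^ (1 / p) :=
          ENNReal.rpow_add_le_add_rpow _ _ (by positivity) ((div_le_one hp0).2 hp.le)
      _ ≤ _ := by
          refine add_le_add hlocal (le_of_eq ?_)
          rw [ENNReal.mul_rpow_of_nonneg _ _ (by positivity), ← ENNReal.rpow_mul,
            mul_one_div_cancel hp0.ne', ENNReal.rpow_one]
  have hthird : (1 / 3 : ℝ) * (3 * r) = r := by ring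
  have hfirst := hN₂ (fun z => (‖f z‖₊ : ℝ≥0∞)) x (3 * r) k (ball x ((k + 3) * r)) A
    (by positivity)
    (fun z hz => ball_subset_ball' (by
      rw [mem_ball] at hz
      rw [hthird]
      linarith))
    (fun z _ => modMorreyNorm_ball_le μ p q k f z (by positivity))
  have hsecond : μ (ball x ((k + 3) * r)) ^ (1 / q - 1 / p) * (c * m ^ (1 / p)) ≤ N₁ * A := by
    calc μ (ball x ((k + 3) * r)) ^ (1 / q - 1 / p) * (c * m ^ (1 / p))
        ≤ m ^ (1 / q - 1 / p) * (c * m ^ (1 / p)) := by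
          gcongr ?_ * _
          refine ENNReal.rpow_le_rpow_of_exponent_nonpos (measure_mono (ball_subset_ball ?_)) hs
          nlinarith
      _ = N₁ * A * (m ^ (1 / q - 1 / p) * m ^ (-(1 / q)) * m ^ (1 / p)) := by
          rw [hc]; ring
      _ ≤ N₁ * A := mul_le_of_le_one_right' (ENNReal.rpow_mul_rpow_mul_rpow_le_one m
          (neg_lt_zero.2 (by positivity)) (by positivity) (by ring))
  calc μ (ball x ((k + 3) * r)) ^ (1 / q - 1 / p) *
        (∫⁻ y in ball x r, modMax μ β f y ^ p ∂μ) ^ (1 / p)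
      ≤ C ^ (1 / p) * (μ (ball x ((k + 3) * r)) ^ (1 / q - 1 / p) *
          (∫⁻ y in ball x (3 * r), (‖f y‖₊ : ℝ≥0∞) ^ p ∂μ) ^ (1 / p)) +
        μ (ball x ((k + 3) * r)) ^ (1 / q - 1 / p) * (c * m ^ (1 / p)) := by
        refine (mul_le_mul' le_rfl hsplit).trans_eq ?_
        ring
    _ ≤ C ^ (1 / p) * (N₂ * A) + N₁ * A := by gcongr
    _ = _ := by ring

theorem stmt16 {X : Type*} [MetricSpace X] [MeasurableSpace X] [BorelSpace X]
    (N₀ : ℕ) (hX : GeomDoubling X N₀) (μ : Measure X) [μ.Regular]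
    (p q : ℝ) (hp : 1 < p) (hpq : p ≤ q)
    (β k : ℝ) (hβ : 1 < β) (hk : 1 < k) :
    ∃ C : ℝ, 0 < C ∧
      ∀ f : X → ℝ, Measurable f → modMorreyNorm μ p q k f < ⊤ →
        modMorreyNormE μ p q k (modMax μ β f) ≤
          ENNReal.ofReal C * modMorreyNorm μ p q k f := by
  have hp0 : 0 < p := by linarith
  have hs : 1 / q - 1 / p ≤ 0 := sub_nonpos.2 (one_div_le_one_div_of_le hp0 hpq)
  obtain ⟨C, hC, hbound⟩ := hX.exists_modMax_ball_bound μ hp hpq hβ (zero_lt_one.trans hk)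
  have hε : 0 < (k - 1) / (k + 3) := div_pos (by linarith) (by linarith)
  obtain ⟨N, hN⟩ := hX.exists_morrey_ball_bound μ hp.le hs hε
  refine ⟨(N * C).toReal + 1, by positivity, fun f hf _ => ?_⟩
  have hle : N * C ≤ ENNReal.ofReal ((N * C).toReal + 1) := by
    rw [ENNReal.le_ofReal_iff_toReal_le (by finiteness) (by positivity)]
    linarith
  refine iSup_le fun x => iSup₂_le fun r hr => ?_
  calc _ ≤ N * (C * modMorreyNorm μ p q k f) :=
        hN (modMax μ β f) x r (k + 3) _ _ hr
          (fun y hy => ball_subset_ball' (by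
            rw [mem_ball] at hy
            have : (k + 3) * ((k - 1) / (k + 3) * r) = (k - 1) * r := by field_simp
            linarith))
          fun y _ => hbound f hf y _ (mul_pos hε hr)
    _ = N * C * modMorreyNorm μ p q k f := (mul_assoc _ _ _).symm
    _ ≤ _ := by gcongr
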